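/- Let V₁(β) = ‖Σ^{1/2}(β − B̂)‖². Then for every β ∈ ℝ^p, ∫_{ℝ^p} V₁(β') k_AC(β,β') dβ' ≤ λ · V₁(β) + 2p, where λ = sup_{t∈(0,1)} sup_{α∈ℝ^p, α≠0} ‖Σ^{−1/2} Xᵀ D(B̂+tα) X α‖² / ‖Σ^{1/2} α‖². -/

import Mathlib

open MeasureTheory Matrix Filter

noncomputable section

/-- standard normal pdf -/
def nphi (x : ℝ) : ℝ := (Real.sqrt (2 * Real.pi))⁻¹ * Real.exp (-(x ^ 2) / 2)

/-- standard normal cdf -/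
def nPhi (x : ℝ) : ℝ := ∫ t in Set.Iic x, nphi t

/-- density of TN(θ,1;1) (if b = true) resp. TN(θ,1;0) (if b = false) at z -/
def tn (θ : ℝ) (b : Bool) (z : ℝ) : ℝ :=
  if b then (if 0 < z then nphi (z - θ) / nPhi θ else 0)
  else (if z < 0 then nphi (z - θ) / (1 - nPhi θ) else 0)

/-- p-variate Gaussian density with mean μ and covariance matrix Λ -/
def mvn {p : ℕ} (μ : Fin p → ℝ) (Λ : Matrix (Fin p) (Fin p) ℝ) (x : Fin p → ℝ) : ℝ :=
  Real.sqrt (((2 * Real.pi) ^ p * Λ.det)⁻¹) *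
    Real.exp (-(dotProduct (x - μ) (Λ⁻¹.mulVec (x - μ))) / 2)

/-- squared Euclidean norm -/
def normSq {m : ℕ} (x : Fin m → ℝ) : ℝ := ∑ i, x i ^ 2

/-- Albert and Chib's Markov transition density, with Σ = XᵀX + Q -/
def kAC {n p : ℕ} (X : Matrix (Fin n) (Fin p) ℝ) (Y : Fin n → Bool)
    (v : Fin p → ℝ) (Q : Matrix (Fin p) (Fin p) ℝ) (β β' : Fin p → ℝ) : ℝ :=
  ∫ z : Fin n → ℝ,
    mvn ((Xᵀ * X + Q)⁻¹.mulVec (Xᵀ.mulVec z + Q.mulVec v)) (Xᵀ * X + Q)⁻¹ β' *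
      ∏ i, tn (dotProduct (X i) β) (Y i) (z i)

/-- the defining property of the posterior mode B̂ -/
def IsPosteriorMode {n p : ℕ} (X : Matrix (Fin n) (Fin p) ℝ) (Y : Fin n → Bool)
    (v : Fin p → ℝ) (Q : Matrix (Fin p) (Fin p) ℝ) (Bhat : Fin p → ℝ) : Prop :=
  (∑ i, (if Y i then nphi (dotProduct (X i) Bhat) / nPhi (dotProduct (X i) Bhat)
          else -(nphi (dotProduct (X i) Bhat) / (1 - nPhi (dotProduct (X i) Bhat)))) • X i)
    - Q.mulVec (Bhat - v) = 0

/-- g(θ) = θφ(θ)/Φ(θ) + (φ(θ)/Φ(θ))² -/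
def gfun (θ : ℝ) : ℝ := θ * nphi θ / nPhi θ + (nphi θ / nPhi θ) ^ 2

/-- the diagonal matrix D(β) -/
def Dmat {n p : ℕ} (X : Matrix (Fin n) (Fin p) ℝ) (Y : Fin n → Bool) (β : Fin p → ℝ) :
    Matrix (Fin n) (Fin n) ℝ :=
  Matrix.diagonal fun i =>
    1 - (if Y i then gfun (dotProduct (X i) β) else gfun (-(dotProduct (X i) β)))

lemma nphi_pos (x : ℝ) : 0 < nphi x := by unfold nphi; positivity

lemma nphi_neg (x : ℝ) : nphi (-x) = nphi x := by simp [nphi]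

lemma nphi_cont : Continuous nphi := by unfold nphi; fun_prop

lemma nphi_hasDerivAt (x : ℝ) : HasDerivAt nphi (-x * nphi x) x := by
  unfold nphi
  have h : HasDerivAt (fun x : ℝ => -(x ^ 2) / 2) (-x) x := by
    have := ((hasDerivAt_id x).pow 2).neg.div_const 2
    convert! this using 1
    simp
    ring
  have := (h.exp).const_mul ((Real.sqrt (2 * Real.pi))⁻¹)
  convert! this using 1
  ring

lemma nphi_pow_integrable (k : ℕ) : Integrable (fun z : ℝ => z ^ k * nphi z) := by
  have h := (integrable_rpow_mul_exp_neg_mul_sq (b := 1/2) (by norm_num) (s := (k : ℝ))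
    (by have : (0 : ℝ) ≤ k := by positivity
        linarith)).const_mul ((Real.sqrt (2 * Real.pi))⁻¹)
  refine h.congr (Eventually.of_forall fun z => ?_)
  simp only [nphi, Real.rpow_natCast]
  have : -(1/2 : ℝ) * z ^ 2 = -(z ^ 2) / 2 := by ring
  rw [this]; ring

lemma nphi_integrable : Integrable nphi := by simpa using nphi_pow_integrable 0

lemma nphi_integral : ∫ z, nphi z = 1 := by
  have h := ProbabilityTheory.integral_gaussianPDFReal_eq_one 0 (v := 1) (by norm_num)
  rw [← h]
  congr 1
  ext z
  simp [nphi, ProbabilityTheory.gaussianPDFReal]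

/-- moments of a (sub)density -/
structure Mom (f : ℝ → ℝ) (m V : ℝ) : Prop where
  nn : ∀ z, 0 ≤ f z
  meas : Measurable f
  i0 : Integrable f
  i1 : Integrable (fun z => (z - m) * f z)
  i2 : Integrable (fun z => (z - m) ^ 2 * f z)
  e0 : ∫ z, f z = 1
  e1 : ∫ z, (z - m) * f z = 0
  e2 : ∫ z, (z - m) ^ 2 * f z = V

lemma mom_nphi : Mom nphi 0 1 := by
  have i1 : Integrable (fun z => z * nphi z) := by simpa using nphi_pow_integrable 1
  have i2 := nphi_pow_integrable 2
  refine ⟨fun z => (nphi_pos z).le, nphi_cont.measurable, nphi_integrable, by simpa using i1,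
    by simpa using i2, nphi_integral, ?_, ?_⟩
  · have := integral_eq_zero_of_hasDerivAt_of_integrable (f := nphi) (f' := fun z => -z * nphi z)
      nphi_hasDerivAt (by simpa using i1.neg) nphi_integrable
    simp only [neg_mul, integral_neg, neg_eq_zero] at this
    simpa using this
  · have hd : ∀ z, HasDerivAt (fun z => z * nphi z) (nphi z - z ^ 2 * nphi z) z := by
      intro z
      have := (hasDerivAt_id z).mul (nphi_hasDerivAt z)
      convert! this using 1
      simp; ring
    have := integral_eq_zero_of_hasDerivAt_of_integrable hd (nphi_integrable.sub i2) i1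
    rw [integral_sub nphi_integrable i2, nphi_integral] at this
    simp only [sub_zero]
    linarith

lemma nPhi_pos (x : ℝ) : 0 < nPhi x := by
  unfold nPhi
  rw [setIntegral_pos_iff_support_of_nonneg_ae (Eventually.of_forall fun z => (nphi_pos z).le)
    nphi_integrable.integrableOn]
  have : Function.support nphi = Set.univ := by
    ext z; simp [(nphi_pos z).ne']
  simp [this]

lemma nPhi_neg (x : ℝ) : 1 - nPhi x = nPhi (-x) := by
  have h := integral_comp_neg_Ioi x nphi
  simp only [nphi_neg] at h
  unfold nPhi
  rw [← h, ← nphi_integral, ← intervalIntegral.integral_Iic_add_Ioi (b := x) nphi_integrable.integrableOn nphi_integrable.integrableOn]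
  ring

lemma nPhi_hasDerivAt (x : ℝ) : HasDerivAt nPhi (nphi x) x := by
  have : nPhi = fun x => nPhi 0 + ∫ t in (0:ℝ)..x, nphi t := by
    ext y
    have := intervalIntegral.integral_Iic_sub_Iic (f := nphi) (a := 0) (b := y) (μ := volume)
      nphi_integrable.integrableOn nphi_integrable.integrableOn
    unfold nPhi
    linarith
  rw [this]
  exact (intervalIntegral.integral_hasDerivAt_right (nphi_cont.intervalIntegrable _ _)
    (nphi_cont.stronglyMeasurableAtFilter _ _) nphi_cont.continuousAt).const_add _

lemma shift_i (θ : ℝ) : Integrable (fun z => nphi (z - θ)) ∧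
    Integrable (fun z => z * nphi (z - θ)) ∧ Integrable (fun z => z ^ 2 * nphi (z - θ)) := by
  have h0 := (nphi_pow_integrable 0).comp_sub_right θ
  have h1 := (nphi_pow_integrable 1).comp_sub_right θ
  have h2 := (nphi_pow_integrable 2).comp_sub_right θ
  refine ⟨by simpa using h0, ?_, ?_⟩
  · refine (h1.add (h0.const_mul θ)).congr (Eventually.of_forall fun z => ?_)
    simp; ring
  · refine ((h2.add (h1.const_mul (2 * θ))).add (h0.const_mul (θ ^ 2))).congr
      (Eventually.of_forall fun z => ?_)
    simp; ring

lemma trunc_e0 (θ : ℝ) : ∫ z in Set.Ioi (0:ℝ), nphi (z - θ) = nPhi θ := by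
  rw [← integral_Ici_eq_integral_Ioi, ← integral_indicator measurableSet_Ici, nPhi,
    ← integral_indicator measurableSet_Iic, ← integral_sub_left_eq_self _ _ θ]
  congr 1
  ext z
  simp [Set.indicator, nphi_neg]

lemma shift_deriv (θ z : ℝ) : HasDerivAt (fun z => nphi (z - θ)) (-(z - θ) * nphi (z - θ)) z :=
  (nphi_hasDerivAt (z - θ)).comp_sub_const z θ

lemma trunc_e1 (θ : ℝ) : ∫ z in Set.Ioi (0:ℝ), z * nphi (z - θ) = θ * nPhi θ + nphi θ := by
  obtain ⟨h0, h1, h2⟩ := shift_i θ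
  have hi : Integrable (fun z => -(z - θ) * nphi (z - θ)) :=
    ((h0.const_mul θ).sub h1).congr (Eventually.of_forall fun z => by simp; ring)
  have ht := tendsto_zero_of_hasDerivAt_of_integrableOn_Ioi (a := 0)
    (fun z _ => shift_deriv θ z) hi.integrableOn h0.integrableOn
  have := integral_Ioi_of_hasDerivAt_of_tendsto' (a := 0) (fun z _ => shift_deriv θ z)
    hi.integrableOn ht
  have e : ∀ z, -(z - θ) * nphi (z - θ) = θ * nphi (z - θ) - z * nphi (z - θ) := fun z => by ring
  simp only [e] at this
  rw [integral_sub (h0.const_mul θ).integrableOn h1.integrableOn, integral_const_mul,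
    trunc_e0] at this
  simp [nphi_neg] at this
  linarith

lemma trunc_e2 (θ : ℝ) :
    ∫ z in Set.Ioi (0:ℝ), z ^ 2 * nphi (z - θ) = (θ ^ 2 + 1) * nPhi θ + θ * nphi θ := by
  obtain ⟨h0, h1, h2⟩ := shift_i θ
  have hd : ∀ z, HasDerivAt (fun z => z * nphi (z - θ))
      (nphi (z - θ) + θ * (z * nphi (z - θ)) - z ^ 2 * nphi (z - θ)) z := by
    intro z
    have := (hasDerivAt_id z).mul (shift_deriv θ z)
    convert! this using 1
    simp; ring
  have hi := (h0.add (h1.const_mul θ)).sub h2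
  have ht := tendsto_zero_of_hasDerivAt_of_integrableOn_Ioi (a := 0)
    (fun z _ => hd z) hi.integrableOn h1.integrableOn
  have := integral_Ioi_of_hasDerivAt_of_tendsto' (a := 0) (fun z _ => hd z)
    hi.integrableOn ht
  rw [integral_sub (f := fun z => nphi (z - θ) + θ * (z * nphi (z - θ)))
      (h0.add (h1.const_mul θ)).integrableOn h2.integrableOn,
    integral_add h0.integrableOn (h1.const_mul θ).integrableOn, integral_const_mul,
    trunc_e0, trunc_e1] at this
  simp at this
  linarith

lemma mom_trunc (θ : ℝ) : Mom (tn θ true) (θ + nphi θ / nPhi θ) (1 - gfun θ) := by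
  obtain ⟨h0, h1, h2⟩ := shift_i θ
  have hP := nPhi_pos θ
  have ht : tn θ true = (Set.Ioi (0:ℝ)).indicator (fun z => nphi (z - θ) / nPhi θ) := by
    ext z; simp [tn, Set.indicator]
  set m := θ + nphi θ / nPhi θ with hm
  have e1 : ∀ z, (z - m) * tn θ true z = (Set.Ioi (0:ℝ)).indicator
      (fun z => (z * nphi (z - θ) - m * nphi (z - θ)) / nPhi θ) z := by
    intro z; rw [ht]; simp only [Set.indicator]; split_ifs
    · ring
    · simp
  have e2 : ∀ z, (z - m) ^ 2 * tn θ true z = (Set.Ioi (0:ℝ)).indicator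
      (fun z => (z ^ 2 * nphi (z - θ) - (2 * m) * (z * nphi (z - θ)) + m ^ 2 * nphi (z - θ)) / nPhi θ) z := by
    intro z; rw [ht]; simp only [Set.indicator]; split_ifs
    · ring
    · simp
  have j0 := h0.div_const (nPhi θ)
  have j1 := (h1.sub (h0.const_mul m)).div_const (nPhi θ)
  have j2 := ((h2.sub (h1.const_mul (2 * m))).add (h0.const_mul (m ^ 2))).div_const (nPhi θ)
  refine ⟨?_, ?_, ?_, ?_, ?_, ?_, ?_, ?_⟩
  · intro z; simp only [tn]; split_ifs
    · exact (div_pos (nphi_pos _) hP).le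
    · exact le_rfl
    · simp_all
    · simp_all
  · rw [ht]
    exact ((nphi_cont.measurable.comp (measurable_id.sub_const θ)).div_const _).indicator measurableSet_Ioi
  · rw [ht]; exact j0.indicator measurableSet_Ioi
  · simp_rw [e1]; exact j1.indicator measurableSet_Ioi
  · simp_rw [e2]; exact j2.indicator measurableSet_Ioi
  · rw [ht, integral_indicator measurableSet_Ioi, integral_div, trunc_e0, div_self hP.ne']
  · simp_rw [e1]
    rw [integral_indicator measurableSet_Ioi, integral_div,
      integral_sub h1.integrableOn (h0.const_mul m).integrableOn, integral_const_mul,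
      trunc_e0, trunc_e1, hm]
    field_simp; ring
  · simp_rw [e2]
    rw [integral_indicator measurableSet_Ioi, integral_div,
      integral_add (f := fun z => z ^ 2 * nphi (z - θ) - (2 * m) * (z * nphi (z - θ))) (h2.sub (h1.const_mul (2 * m))).restrict (h0.const_mul (m ^ 2)).restrict,
      integral_sub h2.integrableOn (h1.const_mul (2 * m)).integrableOn, integral_const_mul,
      integral_const_mul, trunc_e0, trunc_e1, trunc_e2, hm, gfun]
    field_simp; ring

lemma tn_false (θ z : ℝ) : tn θ false z = tn (-θ) true (-z) := by
  simp only [tn, nPhi_neg]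
  have : -z - -θ = -(z - θ) := by ring
  rw [this, nphi_neg]
  simp

/-- conditional mean -/
def mth (θ : ℝ) (b : Bool) : ℝ :=
  θ + (if b then nphi θ / nPhi θ else -(nphi θ / (1 - nPhi θ)))

/-- conditional variance -/
def vth (θ : ℝ) (b : Bool) : ℝ := 1 - (if b then gfun θ else gfun (-θ))

lemma mom_neg {f : ℝ → ℝ} {m V : ℝ} (h : Mom f m V) : Mom (fun z => f (-z)) (-m) V := by
  have e1 : ∀ z, (z - -m) * f (-z) = - ((-z - m) * f (-z)) := fun z => by ring
  have e2 : ∀ z, (z - -m) ^ 2 * f (-z) = ((-z - m) ^ 2 * f (-z)) := fun z => by ring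
  refine ⟨fun z => h.nn _, h.meas.comp measurable_neg, h.i0.comp_neg, ?_, ?_, ?_, ?_, ?_⟩
  · simp_rw [e1]; exact h.i1.comp_neg.neg
  · simp_rw [e2]; exact h.i2.comp_neg
  · rw [integral_neg_eq_self f, h.e0]
  · simp_rw [e1]
    rw [integral_neg, integral_neg_eq_self (fun z => (z - m) * f z), h.e1, neg_zero]
  · simp_rw [e2]
    rw [integral_neg_eq_self (fun z => (z - m) ^ 2 * f z), h.e2]

lemma mom_tn (θ : ℝ) (b : Bool) : Mom (tn θ b) (mth θ b) (vth θ b) := by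
  cases b
  · have h := mom_neg (mom_trunc (-θ))
    have : tn θ false = fun z => tn (-θ) true (-z) := by ext z; exact tn_false θ z
    rw [this]
    convert! h using 1
    · simp [mth, nPhi_neg, nphi_neg]
      ring
  · simpa [mth, vth] using mom_trunc θ

lemma gfun_le (θ : ℝ) : gfun θ ≤ 1 := by
  have h := mom_trunc θ
  have : 0 ≤ 1 - gfun θ := by
    rw [← h.e2]
    exact integral_nonneg fun z => mul_nonneg (sq_nonneg _) (h.nn z)
  linarith

lemma gfun_nonneg (θ : ℝ) : 0 ≤ gfun θ := by
  have h : 0 ≤ θ * nPhi θ + nphi θ := by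
    rw [← trunc_e1]
    exact setIntegral_nonneg measurableSet_Ioi fun z hz =>
      mul_nonneg (le_of_lt hz) (nphi_pos _).le
  have hP := nPhi_pos θ
  have : gfun θ = (nphi θ / nPhi θ ^ 2) * (θ * nPhi θ + nphi θ) := by
    unfold gfun; field_simp
  rw [this]
  have := nphi_pos θ
  positivity

lemma vth_mem (θ : ℝ) (b : Bool) : 0 ≤ vth θ b ∧ vth θ b ≤ 1 := by
  unfold vth
  have h1 := gfun_le θ
  have h2 := gfun_le (-θ)
  have h3 := gfun_nonneg θ
  have h4 := gfun_nonneg (-θ)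
  split_ifs <;> constructor <;> linarith

lemma mth_deriv (θ : ℝ) (b : Bool) : HasDerivAt (fun θ => mth θ b) (vth θ b) θ := by
  have key : ∀ θ, HasDerivAt (fun θ => nphi θ / nPhi θ) (-gfun θ) θ := by
    intro θ
    have hP := nPhi_pos θ
    have := (nphi_hasDerivAt θ).div (nPhi_hasDerivAt θ) hP.ne'
    convert! this using 1
    unfold gfun; field_simp; ring
  cases b
  · have h := (hasDerivAt_id θ).sub ((key (-θ)).scomp θ (hasDerivAt_neg θ))
    have e : (fun θ => mth θ false) = fun θ => θ - nphi (-θ) / nPhi (-θ) := by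
      ext θ; simp [mth, nPhi_neg, nphi_neg]; ring
    rw [e]
    convert! h using 1
    simp [vth]
  · have h := (hasDerivAt_id θ).add (key θ)
    convert! h using 1

/-- integrable with given integral -/
def HI {α : Type*} [MeasureSpace α] (f : α → ℝ) (c : ℝ) : Prop := Integrable f ∧ ∫ x, f x = c

lemma HI.add {α : Type*} [MeasureSpace α] {f g : α → ℝ} {c d : ℝ} (hf : HI f c) (hg : HI g d) :
    HI (fun x => f x + g x) (c + d) :=
  ⟨hf.1.add hg.1, by rw [integral_add hf.1 hg.1, hf.2, hg.2]⟩

lemma HI.const_mul {α : Type*} [MeasureSpace α] {f : α → ℝ} {c : ℝ} (hf : HI f c) (a : ℝ) :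
    HI (fun x => a * f x) (a * c) :=
  ⟨hf.1.const_mul a, by rw [integral_const_mul, hf.2]⟩

lemma HI.sum {α ι : Type*} [MeasureSpace α] (s : Finset ι) {f : ι → α → ℝ} {c : ι → ℝ}
    (hf : ∀ i, HI (f i) (c i)) :
    HI (fun x => ∑ i ∈ s, f i x) (∑ i ∈ s, c i) :=
  ⟨integrable_finsetSum _ fun i _ => (hf i).1, by
    rw [integral_finsetSum _ fun i _ => (hf i).1]
    exact Finset.sum_congr rfl fun i _ => (hf i).2⟩

lemma HI.prod {n : ℕ} {f : Fin n → ℝ → ℝ} {c : Fin n → ℝ} (hf : ∀ i, HI (f i) (c i)) :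
    HI (fun x : Fin n → ℝ => ∏ i, f i (x i)) (∏ i, c i) :=
  ⟨Integrable.fintype_prod fun i => (hf i).1, by
    rw [integral_fintype_prod_volume_eq_prod]
    exact Finset.prod_congr rfl fun i _ => (hf i).2⟩

lemma HI.congr {α : Type*} [MeasureSpace α] {f g : α → ℝ} {c d : ℝ} (hf : HI f c)
    (h : ∀ x, f x = g x) (hc : c = d) : HI g d := by
  have : f = g := funext h
  rw [← this, ← hc]; exact hf

lemma pm1 {n : ℕ} {f : Fin n → ℝ → ℝ} {m V : Fin n → ℝ} (h : ∀ i, Mom (f i) (m i) (V i))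
    (i : Fin n) : HI (fun z : Fin n → ℝ => (z i - m i) * ∏ k, f k (z k)) 0 := by
  have := HI.prod (f := fun k z => (if k = i then z - m k else 1) * f k z)
    (c := fun k => if k = i then 0 else 1) (fun k => by
      by_cases hk : k = i
      · simp only [hk, if_true]; exact ⟨(h i).i1, (h i).e1⟩
      · simp only [hk, if_false, one_mul]; exact ⟨(h k).i0, (h k).e0⟩)
  refine this.congr (fun z => ?_) ?_
  · rw [Finset.prod_mul_distrib]; simp
  · simp

lemma pm2 {n : ℕ} {f : Fin n → ℝ → ℝ} {m V : Fin n → ℝ} (h : ∀ i, Mom (f i) (m i) (V i))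
    (i j : Fin n) : HI (fun z : Fin n → ℝ => (z i - m i) * (z j - m j) * ∏ k, f k (z k))
      (if i = j then V i else 0) := by
  by_cases hij : i = j
  · subst hij
    have := HI.prod (f := fun k z => (if k = i then (z - m k) ^ 2 else 1) * f k z)
      (c := fun k => if k = i then V k else 1) (fun k => by
        by_cases hk : k = i
        · simp only [hk, if_true]; exact ⟨(h i).i2, (h i).e2⟩
        · simp only [hk, if_false, one_mul]; exact ⟨(h k).i0, (h k).e0⟩)
    refine this.congr (fun z => ?_) ?_
    · rw [Finset.prod_mul_distrib]; simp [sq]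
    · simp
  · have := HI.prod (f := fun k z => (if k = i then (z - m k) else 1) *
        (if k = j then (z - m k) else 1) * f k z)
      (c := fun k => if k = i then 0 else if k = j then 0 else 1) (fun k => by
        by_cases hk : k = i
        · have hk' : ¬ i = j := hij
          simp only [hk, if_true, hk', if_false, mul_one]; exact ⟨(h i).i1, (h i).e1⟩
        · by_cases hk' : k = j
          · have : ¬ j = i := fun e => hij e.symm
            simp only [hk', if_true, this, if_false, one_mul]; exact ⟨(h j).i1, (h j).e1⟩
          · simp only [hk, hk', if_false, one_mul]; exact ⟨(h k).i0, (h k).e0⟩)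
    refine this.congr (fun z => ?_) ?_
    · rw [Finset.prod_mul_distrib, Finset.prod_mul_distrib]; simp
    · rw [if_neg hij]
      exact Finset.prod_eq_zero (Finset.mem_univ i) (by simp)

lemma quad {n q : ℕ} {f : Fin n → ℝ → ℝ} {m V : Fin n → ℝ} (h : ∀ i, Mom (f i) (m i) (V i))
    (b : Fin q → ℝ) (A : Matrix (Fin q) (Fin n) ℝ) :
    HI (fun z : Fin n → ℝ => normSq (b + A.mulVec (z - m)) * ∏ k, f k (z k))
      (normSq b + ∑ i, V i * ∑ k, A k i ^ 2) := by
  have h0 : HI (fun z : Fin n → ℝ => ∏ k, f k (z k)) 1 := by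
    simpa using HI.prod (c := fun _ => 1) (fun i => ⟨(h i).i0, (h i).e0⟩)
  have key := HI.sum (Finset.univ : Finset (Fin q)) (fun k =>
    ((h0.const_mul (b k ^ 2)).add
      ((HI.sum Finset.univ (fun i => (pm1 h i).const_mul (A k i))).const_mul (2 * b k))).add
      (HI.sum Finset.univ (fun i => HI.sum Finset.univ
        (fun j => (pm2 h i j).const_mul (A k i * A k j)))))
  refine key.congr (fun z => ?_) ?_
  · rw [normSq, Finset.sum_mul]
    refine Finset.sum_congr rfl fun k _ => ?_
    have : (b + A.mulVec (z - m)) k = b k + ∑ i, A k i * (z i - m i) := by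
      simp [Matrix.mulVec, dotProduct]
    rw [this, add_sq, sq (∑ i, _), Finset.sum_mul_sum, add_mul, add_mul]
    congr 1
    · congr 1
      rw [mul_assoc (2 * b k), Finset.sum_mul]
      congr 1
      exact Finset.sum_congr rfl fun i _ => by ring
    · rw [Finset.sum_mul]
      refine Finset.sum_congr rfl fun i _ => ?_
      rw [Finset.sum_mul]
      exact Finset.sum_congr rfl fun j _ => by ring
  · simp only [mul_one, mul_zero, Finset.sum_const_zero, add_zero, mul_ite, Finset.sum_ite_eq,
      Finset.mem_univ, if_true, Finset.sum_add_distrib, normSq]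
    congr 1
    rw [Finset.sum_comm]
    refine Finset.sum_congr rfl fun i _ => ?_
    rw [Finset.mul_sum]
    exact Finset.sum_congr rfl fun k _ => by ring

lemma HI.lin {p : ℕ} {F : (Fin p → ℝ) → ℝ} {c : ℝ} (hF : HI F c)
    (S : Matrix (Fin p) (Fin p) ℝ) (hS : S.det ≠ 0) (μ : Fin p → ℝ) :
    HI (fun x => |S.det| * F (S.mulVec (x - μ))) c := by
  have hmap := Real.map_matrix_volume_pi_eq_smul_volume_pi hS
  have hinj : Function.Injective (Matrix.toLin' S) := by
    rw [Matrix.toLin'_apply']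
    exact Matrix.mulVec_injective_of_isUnit ((Matrix.isUnit_iff_isUnit_det S).2 hS.isUnit)
  have hme : MeasurableEmbedding (Matrix.toLin' S) :=
    ((Matrix.toLin' S).isClosedEmbedding_of_injective
      (LinearMap.ker_eq_bot.2 hinj)).measurableEmbedding
  have hc : 0 < |S.det| := abs_pos.2 hS
  have hI : HI (fun x => F (S.mulVec x)) (|S.det|⁻¹ * c) := by
    constructor
    · have : Integrable F (Measure.map (Matrix.toLin' S) volume) := by
        rw [hmap]; exact hF.1.smul_measure ENNReal.ofReal_ne_top
      exact (hme.integrable_map_iff).1 this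
    · have := hme.integral_map (μ := volume) F
      rw [hmap, integral_smul_measure, hF.2, ENNReal.toReal_ofReal (abs_nonneg _), abs_inv] at this
      simpa using this.symm
  have h2 : HI (fun x => F (S.mulVec (x - μ))) (|S.det|⁻¹ * c) :=
    ⟨hI.1.comp_sub_right μ, by
      rw [← hI.2]; exact integral_sub_right_eq_self (fun x => F (S.mulVec x)) μ⟩
  refine (h2.const_mul |S.det|).congr (fun _ => rfl) ?_
  field_simp

lemma mvn_eq {p : ℕ} (S G : Matrix (Fin p) (Fin p) ℝ) (hS : S.det ≠ 0) (hsym : Sᵀ = S)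
    (hG : S * S = G) (μ x : Fin p → ℝ) :
    mvn μ G⁻¹ x = |S.det| * ∏ k, nphi (S.mulVec (x - μ) k) := by
  subst hG
  have hu : IsUnit (S * S).det := by rw [det_mul]; exact (mul_ne_zero hS hS).isUnit
  unfold mvn nphi
  rw [Matrix.nonsing_inv_nonsing_inv _ hu, Finset.prod_mul_distrib, ← Real.exp_sum,
    Matrix.det_nonsing_inv, det_mul]
  have e1 : -((x - μ) ⬝ᵥ (S * S).mulVec (x - μ)) / 2 =
      ∑ k, -(S.mulVec (x - μ) k) ^ 2 / 2 := by
    rw [← Matrix.mulVec_mulVec, Matrix.dotProduct_mulVec]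
    have : (x - μ) ᵥ* S = S.mulVec (x - μ) := by
      rw [← Matrix.mulVec_transpose, hsym]
    rw [this, ← Finset.sum_div, Finset.sum_neg_distrib]
    simp [dotProduct, sq]
  rw [e1, ← mul_assoc]
  congr 1
  rw [Ring.inverse_eq_inv', Finset.prod_const, Finset.card_univ, Fintype.card_fin, mul_inv, inv_inv,
    Real.sqrt_mul (by positivity), Real.sqrt_mul_self_eq_abs, mul_comm]
  congr 1
  rw [Real.sqrt_inv, inv_pow]
  congr 1
  rw [Real.sqrt_eq_iff_mul_self_eq (by positivity) (by positivity), ← mul_pow,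
    Real.mul_self_sqrt (by positivity)]

lemma gauss_quad {p : ℕ} (S G : Matrix (Fin p) (Fin p) ℝ) (hS : S.det ≠ 0) (hsym : Sᵀ = S)
    (hG : S * S = G) (μ B : Fin p → ℝ) :
    HI (fun x => normSq (S.mulVec (x - B)) * mvn μ G⁻¹ x) (normSq (S.mulVec (μ - B)) + p) := by
  have h := quad (n := p) (q := p) (f := fun _ => nphi) (m := fun _ => 0) (V := fun _ => 1)
    (fun _ => mom_nphi) (S.mulVec (μ - B)) 1
  refine (h.lin S hS μ).congr (fun x => ?_) ?_
  · rw [mvn_eq S G hS hsym hG]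
    have : S.mulVec (μ - B) + (1 : Matrix (Fin p) (Fin p) ℝ).mulVec (S.mulVec (x - μ) - fun _ => 0)
        = S.mulVec (x - B) := by
      have h0 : (fun _ => 0 : Fin p → ℝ) = 0 := rfl
      rw [h0, sub_zero, Matrix.one_mulVec, ← Matrix.mulVec_add]
      congr 1; abel
    rw [this]; ring
  · congr 1
    simp [Matrix.one_apply]

lemma normSq_nonneg {m : ℕ} (x : Fin m → ℝ) : 0 ≤ normSq x :=
  Finset.sum_nonneg fun _ _ => sq_nonneg _

lemma normSq_eq_zero {m : ℕ} {x : Fin m → ℝ} (h : normSq x = 0) : x = 0 := by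
  unfold normSq at h
  rw [Finset.sum_eq_zero_iff_of_nonneg fun _ _ => sq_nonneg _] at h
  ext i
  simpa using h i (Finset.mem_univ i)

lemma normSq_mulVec {m q : ℕ} (A : Matrix (Fin m) (Fin q) ℝ) (x : Fin q → ℝ) :
    normSq (A.mulVec x) = x ⬝ᵥ (Aᵀ * A).mulVec x := by
  rw [← Matrix.mulVec_mulVec, Matrix.dotProduct_mulVec, Matrix.vecMul_transpose]
  simp [normSq, dotProduct, sq]

lemma normSq_mulVec_le {m q : ℕ} (A : Matrix (Fin m) (Fin q) ℝ) (x : Fin q → ℝ) :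
    normSq (A.mulVec x) ≤ (∑ k, ∑ i, A k i ^ 2) * normSq x := by
  unfold normSq
  rw [Finset.sum_mul]
  refine Finset.sum_le_sum fun k _ => ?_
  simp only [Matrix.mulVec, dotProduct]
  exact Finset.sum_mul_sq_le_sq_mul_sq _ _ _

lemma mean_val {n p q : ℕ} (X : Matrix (Fin n) (Fin p) ℝ) (Y : Fin n → Bool)
    (A : Matrix (Fin q) (Fin n) ℝ) (B α : Fin p → ℝ) :
    ∃ t ∈ Set.Ioo (0 : ℝ) 1,
      normSq (A.mulVec (fun i => mth (X i ⬝ᵥ (B + α)) (Y i)) -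
        A.mulVec (fun i => mth (X i ⬝ᵥ B) (Y i))) ≤
      normSq ((A * Dmat X Y (B + t • α) * X).mulVec α) := by
  set F : ℝ → Fin q → ℝ := fun t => A.mulVec (fun i => mth (X i ⬝ᵥ (B + t • α)) (Y i)) with hF
  set w := F 1 - F 0 with hw
  have hd : ∀ t : ℝ, HasDerivAt (fun t => w ⬝ᵥ F t)
      (w ⬝ᵥ (A * Dmat X Y (B + t • α) * X).mulVec α) t := by
    intro t
    rw [← Matrix.mulVec_mulVec, ← Matrix.mulVec_mulVec]
    simp only [hF, dotProduct, Matrix.mulVec]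
    refine HasDerivAt.fun_sum fun k _ => HasDerivAt.const_mul _ ?_
    refine HasDerivAt.fun_sum fun i _ => HasDerivAt.const_mul _ ?_
    have h1 : HasDerivAt (fun t : ℝ => X i ⬝ᵥ (B + t • α)) (X i ⬝ᵥ α) t := by
      have : (fun t : ℝ => X i ⬝ᵥ (B + t • α)) = fun t => X i ⬝ᵥ B + t * (X i ⬝ᵥ α) := by
        ext t; simp [dotProduct_add]
      rw [this]
      simpa using ((hasDerivAt_id t).mul_const (X i ⬝ᵥ α)).const_add (X i ⬝ᵥ B)
    have h2 := (mth_deriv (X i ⬝ᵥ (B + t • α)) (Y i)).comp t h1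
    refine h2.congr_deriv ?_
    have h3 := Matrix.mulVec_diagonal (fun i =>
      1 - (if Y i then gfun (dotProduct (X i) (B + t • α)) else gfun (-(dotProduct (X i) (B + t • α)))))
      (X.mulVec α) i
    exact h3.symm
  obtain ⟨c, hc, hs⟩ := exists_hasDerivAt_eq_slope (fun t => w ⬝ᵥ F t) _ (zero_lt_one)
    (fun t _ => (hd t).continuousAt.continuousWithinAt) (fun t _ => hd t)
  refine ⟨c, hc, ?_⟩
  set d := (A * Dmat X Y (B + c • α) * X).mulVec α with hdd
  have e : A.mulVec (fun i => mth (X i ⬝ᵥ (B + α)) (Y i)) -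
        A.mulVec (fun i => mth (X i ⬝ᵥ B) (Y i)) = w := by
    simp [hw, hF]
  rw [e]
  have hww : w ⬝ᵥ d = normSq w := by
    rw [hs, sub_zero, div_one, ← dotProduct_sub, ← hw]
    simp [normSq, dotProduct, sq]
  have hcs : (w ⬝ᵥ d) ^ 2 ≤ normSq w * normSq d := by
    simp only [normSq, dotProduct]
    exact Finset.sum_mul_sq_le_sq_mul_sq _ _ _
  rw [hww] at hcs
  by_contra hlt
  push Not at hlt
  have h0 := normSq_nonneg d
  nlinarith

/-- the drift inequality for V₁(β) = ‖Σ^{1/2}(β − B̂)‖².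
Here `S` is the positive semidefinite square root Σ^{1/2} of Σ = XᵀX + Q and
`T` is the positive semidefinite square root Σ^{-1/2} of Σ⁻¹. -/
theorem drift_inequality_V1
    (n p : ℕ) (hn : 1 ≤ n) (hp : 1 ≤ p)
    (X : Matrix (Fin n) (Fin p) ℝ) (Y : Fin n → Bool)
    (v : Fin p → ℝ) (Q : Matrix (Fin p) (Fin p) ℝ) (hQ : Q.PosSemidef)
    (hSig : IsUnit (Xᵀ * X + Q).det)
    (Bhat : Fin p → ℝ) (hmode : IsPosteriorMode X Y v Q Bhat)
    (S : Matrix (Fin p) (Fin p) ℝ) (hS : S.PosSemidef) (hSS : S * S = Xᵀ * X + Q)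
    (T : Matrix (Fin p) (Fin p) ℝ) (hT : T.PosSemidef) (hTT : T * T = (Xᵀ * X + Q)⁻¹) :
    ∀ β : Fin p → ℝ,
      (∫ β' : Fin p → ℝ, normSq (S.mulVec (β' - Bhat)) * kAC X Y v Q β β')
        ≤ sSup {r : ℝ | ∃ t ∈ Set.Ioo (0 : ℝ) 1, ∃ α : Fin p → ℝ, α ≠ 0 ∧
              r = normSq ((T * Xᵀ * Dmat X Y (Bhat + t • α) * X).mulVec α)
                    / normSq (S.mulVec α)}
            * normSq (S.mulVec (β - Bhat))
          + 2 * p := by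
  intro β
  have hSsym : Sᵀ = S := hS.1
  have hTsym : Tᵀ = T := hT.1
  have hdet : S.det ≠ 0 := by
    intro h0
    rw [← hSS, det_mul, h0] at hSig
    simp at hSig
  set G := Xᵀ * X + Q with hG
  have hGG : G⁻¹ * G = 1 := Matrix.nonsing_inv_mul _ hSig
  have hGG' : G * G⁻¹ = 1 := Matrix.mul_nonsing_inv _ hSig
  set m : Fin n → ℝ := fun i => mth (X i ⬝ᵥ β) (Y i) with hm
  set m0 : Fin n → ℝ := fun i => mth (X i ⬝ᵥ Bhat) (Y i) with hm0
  have hmom : ∀ i, Mom (tn (X i ⬝ᵥ β) (Y i)) (m i) (vth (X i ⬝ᵥ β) (Y i)) :=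
    fun i => mom_tn _ _
  set w : (Fin n → ℝ) → ℝ := fun z => ∏ i, tn (X i ⬝ᵥ β) (Y i) (z i) with hw
  have hw0 : HI w 1 := by
    simpa using HI.prod (c := fun _ => 1) (fun i => ⟨(hmom i).i0, (hmom i).e0⟩)
  have hwnn : ∀ z, 0 ≤ w z := fun z => Finset.prod_nonneg fun i _ => (hmom i).nn _
  have hwmeas : Measurable w :=
    Finset.measurable_fun_prod _ fun i _ => (hmom i).meas.comp (measurable_pi_apply i)
  set μ : (Fin n → ℝ) → (Fin p → ℝ) := fun z => G⁻¹.mulVec (Xᵀ.mulVec z + Q.mulVec v) with hμ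
  have hμc : Continuous μ := by
    simp only [hμ]; fun_prop
  set b := S.mulVec (μ m - Bhat) with hb
  set A := S * G⁻¹ * Xᵀ with hA
  have hsplit : ∀ z, S.mulVec (μ z - Bhat) = b + A.mulVec (z - m) := by
    intro z
    simp only [hb, hA, hμ, ← Matrix.mulVec_mulVec, ← Matrix.mulVec_add]
    congr 1
    rw [Matrix.mulVec_sub Xᵀ, Matrix.mulVec_add, Matrix.mulVec_add, Matrix.mulVec_sub]
    abel
  have hq : HI (fun z => (normSq (S.mulVec (μ z - Bhat)) + p) * w z)
      (normSq b + ∑ i, vth (X i ⬝ᵥ β) (Y i) * ∑ k, A k i ^ 2 + p) := by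
    refine ((quad hmom b A).add (hw0.const_mul (p : ℝ))).congr (fun z => ?_) (by ring)
    rw [hsplit]; simp only [hw]; ring
  have hinner : ∀ z, HI (fun x => normSq (S.mulVec (x - Bhat)) * (mvn (μ z) G⁻¹ x * w z))
      ((normSq (S.mulVec (μ z - Bhat)) + p) * w z) := by
    intro z
    exact ((gauss_quad S G hdet hSsym hSS (μ z) Bhat).const_mul (w z)).congr
      (fun x => by ring) (by ring)
  have hLHS : (∫ β' : Fin p → ℝ, normSq (S.mulVec (β' - Bhat)) * kAC X Y v Q β β') =
      normSq b + ∑ i, vth (X i ⬝ᵥ β) (Y i) * ∑ k, A k i ^ 2 + p := by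
    have e : ∀ β', normSq (S.mulVec (β' - Bhat)) * kAC X Y v Q β β' =
        ∫ z, normSq (S.mulVec (β' - Bhat)) * (mvn (μ z) G⁻¹ β' * w z) := by
      intro β'; rw [integral_const_mul]; rfl
    simp_rw [e]
    rw [integral_integral_swap]
    · rw [← hq.2]
      congr 1
      ext z
      exact (hinner z).2
    · have hmeas : Measurable (Function.uncurry fun (x : Fin p → ℝ) (z : Fin n → ℝ) =>
          normSq (S.mulVec (x - Bhat)) * (mvn (μ z) G⁻¹ x * w z)) := by
        simp only [Function.uncurry_def]
        refine Measurable.mul ?_ (Measurable.mul ?_ (hwmeas.comp measurable_snd))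
        · refine Continuous.measurable ?_
          unfold normSq; fun_prop
        · refine Continuous.measurable ?_
          unfold mvn; fun_prop
      rw [integrable_prod_iff' hmeas.aestronglyMeasurable]
      refine ⟨Eventually.of_forall fun z => (hinner z).1, ?_⟩
      refine hq.1.congr (Eventually.of_forall fun z => ?_)
      simp only [Function.uncurry_apply_pair]
      rw [← (hinner z).2]
      congr 1
      ext x
      rw [Real.norm_of_nonneg]
      exact mul_nonneg (normSq_nonneg _) (mul_nonneg (by unfold mvn; positivity) (hwnn z))
  rw [hLHS]
  have hGsym : (G⁻¹)ᵀ = G⁻¹ := by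
    rw [← hTT, Matrix.transpose_mul, hTsym]
  have htr : ∑ i, vth (X i ⬝ᵥ β) (Y i) * ∑ k, A k i ^ 2 ≤ p := by
    calc ∑ i, vth (X i ⬝ᵥ β) (Y i) * ∑ k, A k i ^ 2 ≤ ∑ i, ∑ k, A k i ^ 2 :=
          Finset.sum_le_sum fun i _ =>
            mul_le_of_le_one_left (Finset.sum_nonneg fun k _ => sq_nonneg _) (vth_mem _ _).2
      _ = (Aᵀ * A).trace := by
          simp [Matrix.trace, Matrix.mul_apply, sq]
      _ = (G⁻¹ * (Xᵀ * X)).trace := by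
          have : Aᵀ * A = X * (G⁻¹ * Xᵀ) := by
            rw [hA, Matrix.transpose_mul, Matrix.transpose_mul, hSsym, hGsym, transpose_transpose]
            calc X * (G⁻¹ * S) * (S * G⁻¹ * Xᵀ) = X * (G⁻¹ * (S * S) * G⁻¹ * Xᵀ) := by
                  simp only [Matrix.mul_assoc]
              _ = _ := by rw [hSS, hGG, Matrix.one_mul]
          rw [this, Matrix.trace_mul_comm, Matrix.mul_assoc]
      _ = p - (G⁻¹ * Q).trace := by
          have : Xᵀ * X = G - Q := by rw [hG]; abel
          rw [this, Matrix.mul_sub, hGG, Matrix.trace_sub, Matrix.trace_one, Fintype.card_fin]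
      _ ≤ p := by
          have h1 : (G⁻¹ * Q).trace = (Tᴴ * Q * T).trace := by
            have : Tᴴ = T := hT.1
            rw [this, ← hTT, Matrix.mul_assoc, Matrix.trace_mul_comm]
          have h2 : 0 ≤ (Tᴴ * Q * T).trace := (hQ.conjTranspose_mul_mul_same T).trace_nonneg
          linarith
  have hB : Bhat = μ m0 := by
    have h1 : Xᵀ.mulVec m0 + Q.mulVec v = G.mulVec Bhat := by
      have hmode' : Xᵀ.mulVec (fun i => m0 i - X i ⬝ᵥ Bhat) - Q.mulVec (Bhat - v) = 0 := by
        rw [← hmode]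
        congr 1
        ext k
        simp only [Matrix.mulVec, dotProduct, Finset.sum_apply, Pi.smul_apply, smul_eq_mul,
          Matrix.transpose_apply]
        refine Finset.sum_congr rfl fun i _ => ?_
        simp only [hm0, mth, dotProduct]
        ring
      have h2 : (fun i => m0 i - X i ⬝ᵥ Bhat) = m0 - X.mulVec Bhat := rfl
      rw [h2, Matrix.mulVec_sub, Matrix.mulVec_sub, Matrix.mulVec_mulVec] at hmode'
      rw [hG, Matrix.add_mulVec]
      rw [← sub_eq_zero, ← hmode']
      abel
    simp only [hμ]
    rw [h1, Matrix.mulVec_mulVec, hGG, Matrix.one_mulVec]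
  have hb2 : normSq b = normSq ((T * Xᵀ).mulVec m - (T * Xᵀ).mulVec m0) := by
    have : b = (S * G⁻¹).mulVec (Xᵀ.mulVec (m - m0)) := by
      rw [hb, hB]
      simp only [hμ]
      rw [← Matrix.mulVec_sub, ← Matrix.mulVec_mulVec, Matrix.mulVec_sub Xᵀ]
      congr 2
      abel
    rw [this, ← Matrix.mulVec_sub, ← Matrix.mulVec_mulVec (m - m0) T Xᵀ]
    rw [normSq_mulVec, normSq_mulVec, Matrix.transpose_mul, hSsym, hGsym, hTsym, hTT]
    congr 2
    calc G⁻¹ * S * (S * G⁻¹) = G⁻¹ * (S * S) * G⁻¹ := by simp only [Matrix.mul_assoc]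
      _ = _ := by rw [hSS, hGG, Matrix.one_mul]
  obtain ⟨t, ht, hle⟩ := mean_val X Y (T * Xᵀ) Bhat (β - Bhat)
  rw [add_sub_cancel] at hle
  have hle' : normSq b ≤ normSq ((T * Xᵀ * Dmat X Y (Bhat + t • (β - Bhat)) * X).mulVec (β - Bhat)) := by
    rw [hb2]; exact hle
  refine le_trans (b := _ + (2 * p : ℝ)) (by linarith : _ ≤ normSq b + 2 * p) ?_
  gcongr
  refine hle'.trans ?_
  by_cases hα : β - Bhat = 0
  · rw [hα]; simp [normSq]
  have hSα : ∀ α : Fin p → ℝ, normSq (S.mulVec α) = normSq (X.mulVec α) + α ⬝ᵥ Q.mulVec α := by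
    intro α
    rw [normSq_mulVec, normSq_mulVec, hSsym, hSS, hG, Matrix.add_mulVec, dotProduct_add]
  have hpos : ∀ α : Fin p → ℝ, α ≠ 0 → 0 < normSq (S.mulVec α) := by
    intro α hα
    refine lt_of_le_of_ne (normSq_nonneg _) fun h0 => hα ?_
    have hz : S.mulVec α = 0 := normSq_eq_zero h0.symm
    have hinj := Matrix.mulVec_injective_of_isUnit
      ((Matrix.isUnit_iff_isUnit_det S).2 hdet.isUnit)
    exact hinj (by rw [hz, Matrix.mulVec_zero])
  rw [← div_le_iff₀ (hpos _ hα)]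
  refine le_csSup ⟨∑ k, ∑ i, (T * Xᵀ) k i ^ 2, ?_⟩ ⟨t, ht, _, hα, rfl⟩
  rintro r ⟨s, -, α, hα, rfl⟩
  rw [div_le_iff₀ (hpos _ hα), ← Matrix.mulVec_mulVec, ← Matrix.mulVec_mulVec]
  refine (normSq_mulVec_le _ _).trans ?_
  refine mul_le_mul_of_nonneg_left ?_
    (Finset.sum_nonneg fun k _ => Finset.sum_nonneg fun i _ => sq_nonneg _)
  rw [hSα]
  have h1 : 0 ≤ α ⬝ᵥ Q.mulVec α := by simpa using hQ.dotProduct_mulVec_nonneg α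
  have h2 : normSq ((Dmat X Y (Bhat + s • α)).mulVec (X.mulVec α)) ≤ normSq (X.mulVec α) := by
    unfold normSq
    refine Finset.sum_le_sum fun i _ => ?_
    rw [Dmat, Matrix.mulVec_diagonal, mul_pow]
    refine mul_le_of_le_one_left (sq_nonneg _) ?_
    have := vth_mem (X i ⬝ᵥ (Bhat + s • α)) (Y i)
    unfold vth at this
    exact pow_le_one₀ this.1 this.2
  linarith
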